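/- For every function V̂ : S → ℝ, every action a, and every k with 1 ≤ k ≤ N−1, replacing the action indicator by the hindsight probability leaves the conditional expectation of the weighted TD error unchanged: E_π[(p_k(a|s,S_k)/π(a|s))·δ_k | S_0 = s] = E_π[(1(A_0=a)/π(a|s))·δ_k | S_0 = s]. -/

import Mathlib

open Finset

attribute [local instance] Classical.propDecidable

namespace HCA

/-- A trajectory of horizon `N`: the actions taken at steps `0, …, N-1` and the
states reached after each step (the start state is fixed separately). -/
abbrev Traj (S A : Type*) (N : ℕ) : Type _ := (Fin N → A) × (Fin N → S)

variable {S A : Type*} [Fintype S] [Fintype A] [Nonempty S] [Nonempty A]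

/-- The state `S_k` of a trajectory with start state `s`. -/
def st {N : ℕ} (s : S) (τ : Traj S A N) : ℕ → S
  | 0 => s
  | k + 1 => if h : k < N then τ.2 ⟨k, h⟩ else s

/-- The action `A_k` of a trajectory. -/
noncomputable def ac {N : ℕ} (τ : Traj S A N) (k : ℕ) : A :=
  if h : k < N then τ.1 ⟨k, h⟩ else Classical.arbitrary A

/-- The probability `P_π(τ) = ∏_{k=0}^{N-1} π(A_k|S_k)·P(S_{k+1}|S_k,A_k)` of a
trajectory starting at `s`. -/
noncomputable def trajP (π : S → A → ℝ) (P : S → A → S → ℝ) (s : S) (N : ℕ)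
    (τ : Traj S A N) : ℝ :=
  ∏ k : Fin N, π (st s τ k) (τ.1 k) * P (st s τ k) (τ.1 k) (st s τ (k + 1))

/-- Expectation `E_π[f | S_0 = s]` over trajectories. -/
noncomputable def expct (π : S → A → ℝ) (P : S → A → S → ℝ) (s : S) (N : ℕ)
    (f : Traj S A N → ℝ) : ℝ :=
  ∑ τ : Traj S A N, trajP π P s N τ * f τ

/-- Variance `Var_π(f | S_0 = s)` over trajectories. -/
noncomputable def vr (π : S → A → ℝ) (P : S → A → S → ℝ) (s : S) (N : ℕ)
    (f : Traj S A N → ℝ) : ℝ :=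
  expct π P s N (fun τ => (f τ - expct π P s N f) ^ 2)

/-- Covariance `cov_π(f, g | S_0 = s)` over trajectories. -/
noncomputable def cv (π : S → A → ℝ) (P : S → A → S → ℝ) (s : S) (N : ℕ)
    (f g : Traj S A N → ℝ) : ℝ :=
  expct π P s N (fun τ => (f τ - expct π P s N f) * (g τ - expct π P s N g))

/-- Probability `P_π(E | S_0 = s)` of an event `E` on trajectories. -/
noncomputable def prE (π : S → A → ℝ) (P : S → A → S → ℝ) (s : S) (N : ℕ)
    (E : Traj S A N → Prop) : ℝ :=
  ∑ τ : Traj S A N, if E τ then trajP π P s N τ else 0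

/-- The TD error `δ_k = r(S_k,A_k) + γ·V̂(S_{k+1}) − V̂(S_k)`. -/
noncomputable def td (r : S → A → ℝ) (γ : ℝ) (V : S → ℝ) (s : S) {N : ℕ}
    (τ : Traj S A N) (k : ℕ) : ℝ :=
  r (st s τ k) (ac τ k) + γ * V (st s τ (k + 1)) - V (st s τ k)

/-- `p_k(s'|s,a) = P_π(S_k = s' | S_0 = s, A_0 = a)
  = P_π(A_0 = a, S_k = s' | S_0 = s) / π(a|s)`. -/
noncomputable def pkSA (π : S → A → ℝ) (P : S → A → S → ℝ) (s : S) (N k : ℕ)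
    (a : A) (s' : S) : ℝ :=
  prE π P s N (fun τ => ac τ 0 = a ∧ st s τ k = s') / π s a

/-- `p_k(s'|s) = Σ_a π(a|s)·p_k(s'|s,a)`. -/
noncomputable def pkS (π : S → A → ℝ) (P : S → A → S → ℝ) (s : S) (N k : ℕ)
    (s' : S) : ℝ :=
  ∑ a : A, π s a * pkSA π P s N k a s'

/-- The hindsight probability `p_k(a|s,s')`, defined as
`P_π(A_0 = a, S_k = s' | S_0 = s)/p_k(s'|s)` when `p_k(s'|s) > 0` and `0` otherwise. -/
noncomputable def pkA (π : S → A → ℝ) (P : S → A → S → ℝ) (s : S) (N k : ℕ)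
    (a : A) (s' : S) : ℝ :=
  if 0 < pkS π P s N k s' then
    prE π P s N (fun τ => ac τ 0 = a ∧ st s τ k = s') / pkS π P s N k s'
  else 0

/-- The `N`-step Monte-Carlo advantage estimator
`Â^MC_N(a) = (1(A_0=a)/π(a|s))·Σ_{k=0}^{N−1} γ^k·δ_k`. -/
noncomputable def mcEst (π : S → A → ℝ) (r : S → A → ℝ) (γ : ℝ) (V : S → ℝ)
    (s : S) (N : ℕ) (a : A) (τ : Traj S A N) : ℝ :=
  ((if ac τ 0 = a then (1 : ℝ) else 0) / π s a) * ∑ k ∈ range N, γ ^ k * td r γ V s τ k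

/-- The `N`-step δHCA advantage estimator
`Â^δHCA_N(a) = (1(A_0=a)/π(a|s))·δ_0 + Σ_{k=1}^{N−1} γ^k·(p_k(a|s,S_k)/π(a|s))·δ_k`. -/
noncomputable def dhcaEst (π : S → A → ℝ) (P : S → A → S → ℝ) (r : S → A → ℝ)
    (γ : ℝ) (V : S → ℝ) (s : S) (N : ℕ) (a : A) (τ : Traj S A N) : ℝ :=
  ((if ac τ 0 = a then (1 : ℝ) else 0) / π s a) * td r γ V s τ 0
    + ∑ k ∈ Ico 1 N, γ ^ k * (pkA π P s N k a (st s τ k) / π s a) * td r γ V s τ k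

/-- `V` satisfies the Bellman equation for `π`:
`V(s₀) = Σ_a π(a|s₀)·(r(s₀,a) + γ·Σ_{s'} P(s'|s₀,a)·V(s'))` for every state `s₀`. -/
def IsBellman (π : S → A → ℝ) (P : S → A → S → ℝ) (r : S → A → ℝ) (γ : ℝ)
    (V : S → ℝ) : Prop :=
  ∀ s₀ : S, V s₀ = ∑ a : A, π s₀ a * (r s₀ a + γ * ∑ s' : S, P s₀ a s' * V s')

/-- The conditional second moment `E_π[δ_k² | S_0 = s, S_k = s']`,
defined as `(Σ_{τ : S_k = s'} P_π(τ)·δ_k(τ)²)/p_k(s'|s)`. -/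
noncomputable def sndMom (π : S → A → ℝ) (P : S → A → S → ℝ) (r : S → A → ℝ)
    (γ : ℝ) (V : S → ℝ) (s : S) (N k : ℕ) (s' : S) : ℝ :=
  (∑ τ : Traj S A N, if st s τ k = s' then trajP π P s N τ * (td r γ V s τ k) ^ 2 else 0)
    / pkS π P s N k s'

/-- Prepend a first action and a first reached state to a trajectory. -/
def tcons {S A : Type*} {N : ℕ} (a : A) (x : S) (τ : Traj S A N) : Traj S A (N + 1) :=
  (Fin.cons a τ.1, Fin.cons x τ.2)

theorem st_tcons {S A : Type*} {N : ℕ} (s : S) (a : A) (x : S) (τ : Traj S A N) (k : ℕ)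
    (hk : k ≤ N) : st s (tcons a x τ) (k + 1) = st x τ k := by
  cases k with
  | zero => simp [st, tcons]
  | succ k =>
    have h1 : k < N := hk
    have h2 : k + 1 < N + 1 := by omega
    simp only [st, tcons, h1, h2, dif_pos]
    exact Fin.cons_succ (α := fun _ => S) x τ.2 ⟨k, h1⟩

theorem ac_tcons_zero {S A : Type*} [Nonempty A] {N : ℕ} (a : A) (x : S) (τ : Traj S A N) :
    ac (tcons a x τ) 0 = a := by
  simp [ac, tcons]

theorem ac_tcons_succ {S A : Type*} [Nonempty A] {N : ℕ} (a : A) (x : S) (τ : Traj S A N) (k : ℕ)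
    (hk : k < N) : ac (tcons a x τ) (k + 1) = ac τ k := by
  have h2 : k + 1 < N + 1 := by omega
  simp only [ac, tcons, hk, h2, dif_pos]
  exact Fin.cons_succ (α := fun _ => A) a τ.1 ⟨k, hk⟩

theorem trajP_tcons {S A : Type*} (π : S → A → ℝ) (P : S → A → S → ℝ)
    (s : S) (N : ℕ) (a : A) (x : S) (τ : Traj S A N) :
    trajP π P s (N + 1) (tcons a x τ) = π s a * P s a x * trajP π P x N τ := by
  unfold trajP
  rw [Fin.prod_univ_succ]
  congr 1
  · refine Finset.prod_congr rfl fun i _ => ?_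
    have h1 := st_tcons s a x τ i i.2.le
    have h2 := st_tcons s a x τ (i + 1) i.2
    simp only [Fin.val_succ, h1, h2]
    simp [tcons]

theorem expct_succ {S A : Type*} [Fintype S] [Fintype A]
    (π : S → A → ℝ) (P : S → A → S → ℝ) (s : S) (N : ℕ) (f : Traj S A (N + 1) → ℝ) :
    expct π P s (N + 1) f
      = ∑ a : A, ∑ x : S, π s a * P s a x * expct π P x N (fun τ => f (tcons a x τ)) := by
  unfold expct
  let e : (A × S) × Traj S A N ≃ Traj S A (N + 1) :=
    { toFun := fun p => tcons p.1.1 p.1.2 p.2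
      invFun := fun τ => ((τ.1 0, τ.2 0), (Fin.tail τ.1, Fin.tail τ.2))
      left_inv := fun p => by simp [tcons]
      right_inv := fun τ => by simp [tcons] }
  rw [← e.sum_comp, Fintype.sum_prod_type, Fintype.sum_prod_type]
  refine Finset.sum_congr rfl fun a _ => Finset.sum_congr rfl fun x _ => ?_
  rw [Finset.mul_sum]
  refine Finset.sum_congr rfl fun τ _ => ?_
  simp only [e, Equiv.coe_fn_mk, trajP_tcons]
  ring

theorem expct_const {S A : Type*} [Fintype S] [Fintype A]
    (π : S → A → ℝ) (P : S → A → S → ℝ) (hπsum : ∀ s₀ : S, ∑ a : A, π s₀ a = 1)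
    (hPsum : ∀ (s₀ : S) (a : A), ∑ s' : S, P s₀ a s' = 1) (c : ℝ) (N : ℕ) :
    ∀ s : S, expct π P s N (fun _ => c) = c := by
  induction N with
  | zero => intro s; simp [expct, trajP]
  | succ N ih =>
    intro s
    rw [expct_succ]
    simp only [ih, ← Finset.sum_mul, ← Finset.mul_sum, hPsum, hπsum, mul_one, one_mul]

theorem markov {S A : Type*} [Fintype S] [Fintype A] [Nonempty A]
    (π : S → A → ℝ) (P : S → A → S → ℝ) (hπsum : ∀ s₀ : S, ∑ a : A, π s₀ a = 1)
    (hPsum : ∀ (s₀ : S) (a : A), ∑ s' : S, P s₀ a s' = 1) (g : S → A → S → ℝ) (k : ℕ) :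
    ∀ (N : ℕ) (s : S), k < N →
      expct π P s N (fun τ => g (st s τ k) (ac τ k) (st s τ (k + 1)))
      = expct π P s N (fun τ => ∑ b : A, ∑ y : S,
          π (st s τ k) b * P (st s τ k) b y * g (st s τ k) b y) := by
  induction k with
  | zero =>
    intro N s hN
    obtain ⟨M, rfl⟩ : ∃ M, N = M + 1 := ⟨N - 1, by omega⟩
    have h0 : ∀ τ : Traj S A (M + 1), st s τ 0 = s := fun _ => rfl
    simp only [h0]
    rw [expct_const π P hπsum hPsum, expct_succ]
    refine Finset.sum_congr rfl fun a _ => Finset.sum_congr rfl fun x _ => ?_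
    have h1 : ∀ τ : Traj S A M, st s (tcons a x τ) (0 + 1) = x :=
      fun τ => st_tcons s a x τ 0 (Nat.zero_le _)
    simp only [h1, ac_tcons_zero]
    rw [expct_const π P hπsum hPsum]
  | succ k ih =>
    intro N s hN
    obtain ⟨M, rfl⟩ : ∃ M, N = M + 1 := ⟨N - 1, by omega⟩
    have hk : k < M := by omega
    rw [expct_succ, expct_succ]
    refine Finset.sum_congr rfl fun a _ => Finset.sum_congr rfl fun x _ => ?_
    simp only [st_tcons s a x _ k hk.le, st_tcons s a x _ (k + 1) hk, ac_tcons_succ a x _ k hk]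
    rw [ih M x hk]

theorem markov_ind {S A : Type*} [Fintype S] [Fintype A] [Nonempty A]
    (π : S → A → ℝ) (P : S → A → S → ℝ) (hπsum : ∀ s₀ : S, ∑ a : A, π s₀ a = 1)
    (hPsum : ∀ (s₀ : S) (a : A), ∑ s' : S, P s₀ a s' = 1) (g : S → A → S → ℝ) (k : ℕ)
    (N : ℕ) (s : S) (hk1 : 1 ≤ k) (hkN : k < N) (w : A → ℝ) :
      expct π P s N (fun τ => w (ac τ 0) * g (st s τ k) (ac τ k) (st s τ (k + 1)))
      = expct π P s N (fun τ => w (ac τ 0) * ∑ b : A, ∑ y : S,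
          π (st s τ k) b * P (st s τ k) b y * g (st s τ k) b y) := by
  obtain ⟨M, rfl⟩ : ∃ M, N = M + 1 := ⟨N - 1, by omega⟩
  obtain ⟨k, rfl⟩ : ∃ j, k = j + 1 := ⟨k - 1, by omega⟩
  have hk : k < M := by omega
  rw [expct_succ, expct_succ]
  refine Finset.sum_congr rfl fun a _ => Finset.sum_congr rfl fun x _ => ?_
  simp only [st_tcons s a x _ k hk.le, st_tcons s a x _ (k + 1) hk, ac_tcons_succ a x _ k hk,
    ac_tcons_zero]
  have h := markov π P hπsum hPsum (fun u b y => w a * g u b y) k M x hk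
  rw [h]
  congr 2
  funext τ
  simp only [Finset.mul_sum]
  refine Finset.sum_congr rfl fun b _ => Finset.sum_congr rfl fun y _ => ?_
  ring

theorem trajP_nonneg {S A : Type*} (π : S → A → ℝ) (P : S → A → S → ℝ)
    (hπpos : ∀ s₀ a, 0 < π s₀ a) (hPnn : ∀ s₀ a s', 0 ≤ P s₀ a s')
    (s : S) (N : ℕ) (τ : Traj S A N) : 0 ≤ trajP π P s N τ :=
  Finset.prod_nonneg fun _ _ => mul_nonneg (hπpos _ _).le (hPnn _ _ _)

theorem prE_nonneg {S A : Type*} [Fintype S] [Fintype A] (π : S → A → ℝ) (P : S → A → S → ℝ)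
    (hπpos : ∀ s₀ a, 0 < π s₀ a) (hPnn : ∀ s₀ a s', 0 ≤ P s₀ a s')
    (s : S) (N : ℕ) (E : Traj S A N → Prop) : 0 ≤ prE π P s N E := by
  refine Finset.sum_nonneg fun τ _ => ?_
  split_ifs
  · exact trajP_nonneg π P hπpos hPnn s N τ
  · exact le_rfl

theorem pkS_eq {S A : Type*} [Fintype S] [Fintype A] [Nonempty A]
    (π : S → A → ℝ) (P : S → A → S → ℝ)
    (hπpos : ∀ s₀ a, 0 < π s₀ a) (s : S) (N k : ℕ) (s' : S) :
    pkS π P s N k s' = ∑ a : A, prE π P s N (fun τ => ac τ 0 = a ∧ st s τ k = s') := by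
  refine Finset.sum_congr rfl fun a _ => ?_
  unfold pkSA
  exact mul_div_cancel₀ _ (hπpos s a).ne'

theorem sum_prE {S A : Type*} [Fintype S] [Fintype A] [Nonempty A]
    (π : S → A → ℝ) (P : S → A → S → ℝ) (s : S) (N k : ℕ) (s' : S) :
    ∑ a : A, prE π P s N (fun τ => ac τ 0 = a ∧ st s τ k = s')
      = prE π P s N (fun τ => st s τ k = s') := by
  unfold prE
  rw [Finset.sum_comm]
  refine Finset.sum_congr rfl fun τ _ => ?_
  by_cases h : st s τ k = s'
  · simp [h]
  · simp [h]

theorem pkA_mul {S A : Type*} [Fintype S] [Fintype A] [Nonempty A]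
    (π : S → A → ℝ) (P : S → A → S → ℝ)
    (hπpos : ∀ s₀ a, 0 < π s₀ a) (hPnn : ∀ s₀ a s', 0 ≤ P s₀ a s')
    (s : S) (N k : ℕ) (a : A) (s' : S) :
    prE π P s N (fun τ => st s τ k = s') * pkA π P s N k a s'
      = prE π P s N (fun τ => ac τ 0 = a ∧ st s τ k = s') := by
  have h1 := pkS_eq π P hπpos s N k s'
  have h2 := sum_prE π P s N k s'
  have h3 : prE π P s N (fun τ => ac τ 0 = a ∧ st s τ k = s') ≤ pkS π P s N k s' := by
    rw [h1]
    exact Finset.single_le_sum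
      (f := fun a => prE π P s N (fun τ => ac τ 0 = a ∧ st s τ k = s'))
      (fun b _ => prE_nonneg π P hπpos hPnn s N _) (Finset.mem_univ a)
  have h4 := prE_nonneg π P hπpos hPnn s N (fun τ => ac τ 0 = a ∧ st s τ k = s')
  rw [← h2, ← h1]
  unfold pkA
  split_ifs with h
  · exact mul_div_cancel₀ _ h.ne'
  · rw [mul_zero]
    exact le_antisymm h4 (h3.trans (not_lt.mp h))

theorem expct_swap {S A : Type*} [Fintype S] [Fintype A] [Nonempty A]
    (π : S → A → ℝ) (P : S → A → S → ℝ)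
    (hπpos : ∀ s₀ a, 0 < π s₀ a) (hPnn : ∀ s₀ a s', 0 ≤ P s₀ a s')
    (s : S) (N k : ℕ) (a : A) (d : S → ℝ) :
    expct π P s N (fun τ => pkA π P s N k a (st s τ k) * d (st s τ k))
      = expct π P s N (fun τ => (if ac τ 0 = a then (1 : ℝ) else 0) * d (st s τ k)) := by
  have hL : expct π P s N (fun τ => pkA π P s N k a (st s τ k) * d (st s τ k))
      = ∑ s' : S, prE π P s N (fun τ => st s τ k = s') * pkA π P s N k a s' * d s' := by
    unfold expct
    rw [show (∑ s' : S, prE π P s N (fun τ => st s τ k = s') * pkA π P s N k a s' * d s')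
      = ∑ s' : S, ∑ τ : Traj S A N, (if st s τ k = s' then trajP π P s N τ else 0)
          * pkA π P s N k a s' * d s' from
      Finset.sum_congr rfl fun s' _ => by unfold prE; rw [Finset.sum_mul, Finset.sum_mul]]
    rw [Finset.sum_comm]
    refine Finset.sum_congr rfl fun τ _ => ?_
    simp [ite_mul, mul_assoc]
  have hR : expct π P s N (fun τ => (if ac τ 0 = a then (1 : ℝ) else 0) * d (st s τ k))
      = ∑ s' : S, prE π P s N (fun τ => ac τ 0 = a ∧ st s τ k = s') * d s' := by
    unfold expct prE
    simp only [Finset.sum_mul]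
    rw [Finset.sum_comm]
    refine Finset.sum_congr rfl fun τ _ => ?_
    by_cases h : ac τ 0 = a
    · simp [h, ite_mul]
    · simp [h]
  rw [hL, hR]
  exact Finset.sum_congr rfl fun s' _ => by rw [pkA_mul π P hπpos hPnn]

theorem stmt_16 {S A : Type*} [Fintype S] [Fintype A] [Nonempty S] [Nonempty A]
    (π : S → A → ℝ) (P : S → A → S → ℝ) (r : S → A → ℝ) (γ : ℝ)
    (N : ℕ) (s : S)
    (hπpos : ∀ s₀ a, 0 < π s₀ a) (hπsum : ∀ s₀ : S, ∑ a : A, π s₀ a = 1)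
    (hPnn : ∀ s₀ a s', 0 ≤ P s₀ a s') (hPsum : ∀ (s₀ : S) (a : A), ∑ s' : S, P s₀ a s' = 1)
    (hγ0 : 0 ≤ γ) (hγ1 : γ ≤ 1) (hN : 1 ≤ N)
    (V : S → ℝ) (a : A) (k : ℕ) (hk1 : 1 ≤ k) (hk2 : k ≤ N - 1) :
    expct π P s N (fun τ => pkA π P s N k a (st s τ k) / π s a * td r γ V s τ k)
      = expct π P s N (fun τ => (if ac τ 0 = a then (1 : ℝ) else 0) / π s a * td r γ V s τ k) := by
  have hkN : k < N := by omega
  let g : S → A → S → ℝ := fun u b y => (r u b + γ * V y - V u) / π s a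
  let d : S → ℝ := fun u => ∑ b : A, ∑ y : S, π u b * P u b y * g u b y
  have hL := markov π P hπsum hPsum (fun u b y => pkA π P s N k a u * g u b y) k N s hkN
  have hR := markov_ind π P hπsum hPsum g k N s hk1 hkN
    (fun b => if b = a then (1 : ℝ) else 0)
  have hS := expct_swap π P hπpos hPnn s N k a d
  calc _ = expct π P s N (fun τ => pkA π P s N k a (st s τ k)
            * g (st s τ k) (ac τ k) (st s τ (k + 1))) := by
        congr 1; funext τ; simp only [g, td]; ring
    _ = expct π P s N (fun τ => pkA π P s N k a (st s τ k) * d (st s τ k)) := by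
        refine hL.trans ?_
        congr 1; funext τ
        simp only [d, Finset.mul_sum]
        refine Finset.sum_congr rfl fun b _ => Finset.sum_congr rfl fun y _ => ?_
        ring
    _ = _ := hS
    _ = _ := hR.symm
    _ = _ := by
        congr 1; funext τ; simp only [g, td]; ring

end HCA
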